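/- For all expressions X and DX, if D(der X, DX) then N(der(der X)) > N(der DX). (This is the level-mapping decrease between the head d(der(der(X)),DDX) and the second recursive body atom d(der(DX),DDX) of the last clause of the derivative program, given the valid interargument relation for the first body atom.) -/

import Mathlib

/-- Expressions built from u, numeric constants, +, * and der. -/
inductive Expr : Type
  | u : Expr
  | num : ℕ → Expr
  | add : Expr → Expr → Expr
  | mul : Expr → Expr → Expr
  | der : Expr → Expr

/-- The norm N: N(u) = 2, N(num n) = 2, N(s+t) = max(N s, N t) + 1,
N(s*t) = max(N s, N t) + 1, N(der s) = 2^(N s). -/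
def N : Expr → ℕ
  | Expr.u => 2
  | Expr.num _ => 2
  | Expr.add s t => max (N s) (N t) + 1
  | Expr.mul s t => max (N s) (N t) + 1
  | Expr.der s => 2 ^ N s

/-- The derivative relation D, defined by the clauses of the program. -/
inductive D : Expr → Expr → Prop
  | base : D (Expr.der Expr.u) (Expr.num 1)
  | number (n : ℕ) : D (Expr.der (Expr.num n)) (Expr.num 0)
  | add {X Y DX DY : Expr} : D (Expr.der X) DX → D (Expr.der Y) DY →
      D (Expr.der (Expr.add X Y)) (Expr.add DX DY)
  | mul {X Y DX DY : Expr} : D (Expr.der X) DX → D (Expr.der Y) DY →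
      D (Expr.der (Expr.mul X Y)) (Expr.add (Expr.mul X DY) (Expr.mul Y DX))
  | der {X DX DDX : Expr} : D (Expr.der X) DX → D (Expr.der DX) DDX →
      D (Expr.der (Expr.der X)) DDX

theorem two_le_N (e : Expr) : 2 ≤ N e := by
  induction e with
  | u => exact le_rfl
  | num n => exact le_rfl
  | add s t hs ht => simp only [N]; omega
  | mul s t hs ht => simp only [N]; omega
  | der s hs =>
    calc 2 ≤ N s := hs
      _ ≤ 2 ^ N s := Nat.lt_two_pow_self.le

theorem D.N_lt {E F : Expr} (h : D E F) : N F < N E := by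
  induction h with
  | base => simp [N]
  | number n => simp [N]
  | @add X Y DX DY _ _ hX hY =>
    simp only [N, pow_succ] at hX hY ⊢
    have h₁ : 2 ^ N X ≤ 2 ^ max (N X) (N Y) :=
      Nat.pow_le_pow_right two_pos (le_max_left _ _)
    have h₂ : 2 ^ N Y ≤ 2 ^ max (N X) (N Y) :=
      Nat.pow_le_pow_right two_pos (le_max_right _ _)
    omega
  | @mul X Y DX DY _ _ hX hY =>
    simp only [N, pow_succ] at hX hY ⊢
    have h₁ : 2 ^ N X ≤ 2 ^ max (N X) (N Y) :=
      Nat.pow_le_pow_right two_pos (le_max_left _ _)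
    have h₂ : 2 ^ N Y ≤ 2 ^ max (N X) (N Y) :=
      Nat.pow_le_pow_right two_pos (le_max_right _ _)
    have h₃ : max (N X) (N Y) < 2 ^ max (N X) (N Y) := Nat.lt_two_pow_self
    have h₄ := two_le_N X
    omega
  | @der X DX DDX _ _ hX hDX =>
    exact hDX.trans (Nat.pow_lt_pow_right one_lt_two hX)

/-- if D (der X) DX then N (der (der X)) > N (der DX). -/
theorem stmt_7 :
    ∀ X DX : Expr, D (Expr.der X) DX →
      N (Expr.der (Expr.der X)) > N (Expr.der DX) := by
  intro X DX h
  exact Nat.pow_lt_pow_right one_lt_two h.N_lt
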